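/- Let d ≥ 2 and let φ be a Minkowski linear functional on generalized permutahedra in ℝ^d, i.e., φ(∅) = 0 and φ(λP + μQ) = λφ(P) + μφ(Q) for all generalized permutahedra P, Q and all λ, μ ≥ 0. Then the following are equivalent: (a) φ(P) ≥ 0 for every generalized permutahedron P, φ(P + {t}) = φ(P) for every generalized permutahedron P and t ∈ ℝ^d, and φ(σ·P) = φ(P) for every generalized permutahedron P and every permutation σ of the coordinates of ℝ^d; (b) there exist nonnegative reals c_1,…,c_{d−1} such that for every nonempty subset I ⊆ [d], φ(Δ_I) = Σ_{k=1}^{d−1} c_k · C(|I|, 2) · C(d − |I|, k − |I| + 1). Moreover, the coefficients c_1,…,c_{d−1} in (b) are uniquely determined by φ (so these functionals form a simplicial cone of dimension d − 1). -/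

import Mathlib

open Finset Pointwise

/-- The standard simplex `Δ_I ⊆ ℝ^d`: the convex hull of `{e_i : i ∈ I}`. -/
def stdSimp (d : ℕ) (I : Finset (Fin d)) : Set (Fin d → ℝ) :=
  convexHull ℝ ((fun i => (Pi.single i 1 : Fin d → ℝ)) '' (I : Set (Fin d)))

/-- The permutahedron `Π_d`: the convex hull of the points `(σ(1),…,σ(d))`. -/
def permutahedron (d : ℕ) : Set (Fin d → ℝ) :=
  convexHull ℝ {x | ∃ σ : Equiv.Perm (Fin d), x = fun i => ((σ i : ℕ) + 1 : ℝ)}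

/-- A polytope is the convex hull of a finite set of points. -/
def IsPolytope {d : ℕ} (P : Set (Fin d → ℝ)) : Prop :=
  ∃ S : Finset (Fin d → ℝ), P = convexHull ℝ (S : Set (Fin d → ℝ))

/-- A generalized permutahedron: a polytope `P` such that `P + Q = λ • Π_d`
for some polytope `Q` and some `λ > 0`. -/
def IsGenPerm {d : ℕ} (P : Set (Fin d → ℝ)) : Prop :=
  IsPolytope P ∧ ∃ lam : ℝ, 0 < lam ∧ ∃ Q : Set (Fin d → ℝ), IsPolytope Q ∧
    P + Q = lam • permutahedron d

/-- The value `f_k(Δ_I) = C(|I|, 2) · C(d − |I|, k − |I| + 1)` (zero if `k − |I| + 1 < 0`),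
as a function of `m = |I|`. -/
noncomputable def fval (d k m : ℕ) : ℝ :=
  (m.choose 2 : ℝ) * (if m ≤ k + 1 then ((d - m).choose (k + 1 - m) : ℝ) else 0)

/-- The support function `u ↦ max_{x ∈ P} ⟨u, x⟩` of a set `P`. -/
noncomputable def supp {d : ℕ} (P : Set (Fin d → ℝ)) (u : Fin d → ℝ) : ℝ :=
  sSup ((fun x => u ⬝ᵥ x) '' P)

section Polytope

variable {d : ℕ} {P Q : Set (Fin d → ℝ)}

lemma IsPolytope.isCompact (hP : IsPolytope P) : IsCompact P := by
  obtain ⟨S, rfl⟩ := hP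
  exact S.finite_toSet.isCompact_convexHull ℝ

lemma IsPolytope.convex (hP : IsPolytope P) : Convex ℝ P := by
  obtain ⟨S, rfl⟩ := hP
  exact convex_convexHull ℝ _

lemma isPolytope_convexHull {A : Set (Fin d → ℝ)} (hA : A.Finite) :
    IsPolytope (convexHull ℝ A) :=
  ⟨hA.toFinset, by simp⟩

lemma IsPolytope.add (hP : IsPolytope P) (hQ : IsPolytope Q) : IsPolytope (P + Q) := by
  obtain ⟨S, rfl⟩ := hP
  obtain ⟨T, rfl⟩ := hQ
  rw [← convexHull_add]
  exact isPolytope_convexHull (S.finite_toSet.add T.finite_toSet)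

lemma IsPolytope.image (hP : IsPolytope P) (f : (Fin d → ℝ) →ₗ[ℝ] (Fin d → ℝ)) :
    IsPolytope (f '' P) := by
  obtain ⟨S, rfl⟩ := hP
  rw [LinearMap.image_convexHull]
  exact isPolytope_convexHull (S.finite_toSet.image f)

lemma IsPolytope.smul (hP : IsPolytope P) (c : ℝ) : IsPolytope (c • P) := by
  obtain ⟨S, rfl⟩ := hP
  rw [← convexHull_smul]
  exact isPolytope_convexHull S.finite_toSet.smul_set

lemma isPolytope_singleton (t : Fin d → ℝ) : IsPolytope {t} :=
  ⟨{t}, by simp⟩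

lemma isLinearMap_dotProduct (u : Fin d → ℝ) : IsLinearMap ℝ (fun x : Fin d → ℝ => u ⬝ᵥ x) :=
  ⟨dotProduct_add u, fun c x => dotProduct_smul c u x⟩

lemma continuous_dotProduct_left (u : Fin d → ℝ) : Continuous (fun x : Fin d → ℝ => u ⬝ᵥ x) := by
  unfold dotProduct
  fun_prop

lemma IsPolytope.bddAbove (hP : IsPolytope P) (u : Fin d → ℝ) :
    BddAbove ((fun x => u ⬝ᵥ x) '' P) :=
  (hP.isCompact.image (continuous_dotProduct_left u)).bddAbove

lemma IsPolytope.dotProduct_le_supp (hP : IsPolytope P) (u : Fin d → ℝ) {x : Fin d → ℝ}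
    (hx : x ∈ P) : u ⬝ᵥ x ≤ supp P u :=
  le_csSup (hP.bddAbove u) ⟨x, hx, rfl⟩

lemma supp_convexHull_eq {A : Set (Fin d → ℝ)} {u x₀ : Fin d → ℝ} (hx₀ : x₀ ∈ A)
    (h : ∀ x ∈ A, u ⬝ᵥ x ≤ u ⬝ᵥ x₀) : supp (convexHull ℝ A) u = u ⬝ᵥ x₀ := by
  refine IsGreatest.csSup_eq ⟨⟨x₀, subset_convexHull ℝ A hx₀, rfl⟩, ?_⟩
  rintro _ ⟨x, hx, rfl⟩
  exact convexHull_min h (convex_halfSpace_le (isLinearMap_dotProduct u) _) hx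

lemma supp_add (hP : IsPolytope P) (hQ : IsPolytope Q) (hP' : P.Nonempty) (hQ' : Q.Nonempty)
    (u : Fin d → ℝ) : supp (P + Q) u = supp P u + supp Q u := by
  unfold supp
  rw [← csSup_add (hP'.image _) (hP.bddAbove u) (hQ'.image _) (hQ.bddAbove u)]
  congr 1
  exact Set.image_add (isLinearMap_dotProduct u).mk'

lemma supp_smul {c : ℝ} (hc : 0 ≤ c) (P : Set (Fin d → ℝ)) (u : Fin d → ℝ) :
    supp (c • P) u = c * supp P u := by
  unfold supp
  rw [← smul_eq_mul, ← Real.sSup_smul_of_nonneg hc]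
  congr 1
  exact Set.image_smul_comm _ _ _ fun x => dotProduct_smul c u x

lemma supp_smul_right {c : ℝ} (hc : 0 ≤ c) (P : Set (Fin d → ℝ)) (u : Fin d → ℝ) :
    supp P (c • u) = c * supp P u := by
  unfold supp
  rw [← smul_eq_mul, ← Real.sSup_smul_of_nonneg hc]
  congr 1
  ext y
  simp [Set.mem_smul_set]

lemma supp_zero_right (P : Set (Fin d → ℝ)) : supp P 0 = 0 := by
  simpa using supp_smul_right le_rfl P 0

lemma supp_singleton (t u : Fin d → ℝ) : supp {t} u = u ⬝ᵥ t := by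
  simp [supp]

lemma supp_add_le (hP : IsPolytope P) (hP' : P.Nonempty) (u v : Fin d → ℝ) :
    supp P (u + v) ≤ supp P u + supp P v := by
  refine csSup_le (hP'.image _) ?_
  rintro _ ⟨x, hx, rfl⟩
  simp only [add_dotProduct]
  exact add_le_add (hP.dotProduct_le_supp u hx) (hP.dotProduct_le_supp v hx)

lemma supp_image_perm (P : Set (Fin d → ℝ)) (σ : Equiv.Perm (Fin d)) (u : Fin d → ℝ) :
    supp ((fun x : Fin d → ℝ => fun a => x (σ a)) '' P) u = supp P (u ∘ σ.symm) := by
  unfold supp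
  rw [Set.image_image]
  congr 1
  refine Set.image_congr fun x _ => ?_
  exact (comp_equiv_symm_dotProduct u x σ).symm

lemma subset_of_supp_le (hP : IsPolytope P) (hQ : IsPolytope Q) (hQ' : Q.Nonempty)
    (h : ∀ u, supp P u ≤ supp Q u) : P ⊆ Q := by
  intro x hx
  by_contra hxQ
  obtain ⟨f, r, hf, hr⟩ :=
    geometric_hahn_banach_closed_point hQ.convex hQ.isCompact.isClosed hxQ
  have hf' : ∀ y, f y = (fun i => f (Pi.single i 1)) ⬝ᵥ y := fun y => by
    conv_lhs => rw [pi_eq_sum_univ' y]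
    simp [dotProduct, mul_comm]
  have h1 := hP.dotProduct_le_supp (fun i => f (Pi.single i 1)) hx
  have h2 : supp Q (fun i => f (Pi.single i 1)) ≤ r := by
    refine csSup_le (hQ'.image _) ?_
    rintro _ ⟨y, hy, rfl⟩
    exact (hf' y ▸ hf y hy).le
  rw [← hf'] at h1
  linarith [h fun i => f (Pi.single i 1)]

lemma eq_of_supp_eq (hP : IsPolytope P) (hQ : IsPolytope Q) (hP' : P.Nonempty)
    (hQ' : Q.Nonempty) (h : ∀ u, supp P u = supp Q u) : P = Q :=
  (subset_of_supp_le hP hQ hQ' fun u => (h u).le).antisymm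
    (subset_of_supp_le hQ hP hP' fun u => (h u).ge)

end Polytope

/-- The indicator vector of a finset. -/
def indVec {d : ℕ} (S : Finset (Fin d)) : Fin d → ℝ := fun i => if i ∈ S then 1 else 0

/-- A nonempty polytope whose support function is additive on each cone of the braid
arrangement, that is, on vectors sorted by a common permutation. -/
structure IsBraidPolytope {d : ℕ} (P : Set (Fin d → ℝ)) : Prop where
  isPolytope : IsPolytope P
  nonempty : P.Nonempty
  supp_add_of_sorted : ∀ (τ : Equiv.Perm (Fin d)) (u v : Fin d → ℝ), Monotone (u ∘ τ) →
    Monotone (v ∘ τ) → supp P (u + v) = supp P u + supp P v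

section Braid

variable {d : ℕ} {P Q : Set (Fin d → ℝ)}

lemma IsBraidPolytope.add (hP : IsBraidPolytope P) (hQ : IsBraidPolytope Q) :
    IsBraidPolytope (P + Q) where
  isPolytope := hP.isPolytope.add hQ.isPolytope
  nonempty := hP.nonempty.add hQ.nonempty
  supp_add_of_sorted τ u v hu hv := by
    simp only [supp_add hP.isPolytope hQ.isPolytope hP.nonempty hQ.nonempty,
      hP.supp_add_of_sorted τ u v hu hv, hQ.supp_add_of_sorted τ u v hu hv]
    ring

lemma IsBraidPolytope.smul (hP : IsBraidPolytope P) {c : ℝ} (hc : 0 ≤ c) :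
    IsBraidPolytope (c • P) where
  isPolytope := hP.isPolytope.smul c
  nonempty := hP.nonempty.smul_set
  supp_add_of_sorted τ u v hu hv := by
    simp only [supp_smul hc, hP.supp_add_of_sorted τ u v hu hv]
    ring

lemma isBraidPolytope_singleton (t : Fin d → ℝ) : IsBraidPolytope {t} where
  isPolytope := isPolytope_singleton t
  nonempty := Set.singleton_nonempty t
  supp_add_of_sorted τ u v _ _ := by simp only [supp_singleton, add_dotProduct]

lemma isBraidPolytope_sum {ι : Type*} {s : Finset ι} {F : ι → Set (Fin d → ℝ)}
    (hF : ∀ i ∈ s, IsBraidPolytope (F i)) : IsBraidPolytope (∑ i ∈ s, F i) :=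
  Finset.sum_induction F IsBraidPolytope (fun _ _ => .add)
    (isBraidPolytope_singleton 0) hF

lemma supp_sum {ι : Type*} {s : Finset ι} {F : ι → Set (Fin d → ℝ)}
    (hF : ∀ i ∈ s, IsBraidPolytope (F i)) (u : Fin d → ℝ) :
    supp (∑ i ∈ s, F i) u = ∑ i ∈ s, supp (F i) u := by
  classical
  induction s using Finset.induction_on with
  | empty => simpa [Set.singleton_zero] using supp_singleton (0 : Fin d → ℝ) u
  | insert a s ha ih =>
    have h1 := hF a (mem_insert_self a s)
    have h2 : ∀ i ∈ s, IsBraidPolytope (F i) := fun i hi => hF i (mem_insert_of_mem hi)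
    have h3 := isBraidPolytope_sum h2
    rw [sum_insert ha, sum_insert ha,
      supp_add h1.isPolytope h3.isPolytope h1.nonempty h3.nonempty, ih h2]

/-- A Minkowski summand of a braid polytope is a braid polytope. -/
lemma IsBraidPolytope.of_add (hP : IsPolytope P) (hQ : IsPolytope Q)
    (h : IsBraidPolytope (P + Q)) : IsBraidPolytope P := by
  obtain ⟨hP', hQ'⟩ := Set.add_nonempty.1 h.nonempty
  refine ⟨hP, hP', fun τ u v hu hv => ?_⟩
  have h1 := h.supp_add_of_sorted τ u v hu hv
  simp only [supp_add hP hQ hP' hQ'] at h1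
  linarith [supp_add_le hP hP' u v, supp_add_le hQ hQ' u v]

lemma IsBraidPolytope.supp_sum_of_sorted (hP : IsBraidPolytope P) (τ : Equiv.Perm (Fin d))
    {ι : Type*} (s : Finset ι) (w : ι → Fin d → ℝ) (hw : ∀ i ∈ s, Monotone (w i ∘ τ)) :
    supp P (∑ i ∈ s, w i) = ∑ i ∈ s, supp P (w i) ∧ Monotone ((∑ i ∈ s, w i) ∘ τ) := by
  classical
  induction s using Finset.induction_on with
  | empty => exact ⟨by simpa using supp_zero_right P, monotone_const (c := (0 : ℝ))⟩
  | insert a s ha ih =>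
    have h1 := hw a (mem_insert_self a s)
    obtain ⟨h2, h3⟩ := ih fun i hi => hw i (mem_insert_of_mem hi)
    rw [sum_insert ha, sum_insert ha, hP.supp_add_of_sorted τ _ _ h1 h3, h2]
    exact ⟨rfl, h1.add h3⟩

lemma exists_sorted_decomposition {n : ℕ} (τ : Equiv.Perm (Fin (n + 1))) (u : Fin (n + 1) → ℝ)
    (hu : Monotone (u ∘ τ)) : ∃ (r : ℝ) (c : Fin n → ℝ) (S : Fin n → Finset (Fin (n + 1))),
      (∀ i, 0 ≤ c i) ∧ (∀ i, Monotone (indVec (S i) ∘ τ)) ∧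
      u = r • indVec univ + ∑ i, c i • indVec (S i) := by
  refine ⟨u (τ 0), fun i => u (τ i.succ) - u (τ i.castSucc),
    fun i => univ.filter fun j => i.succ ≤ τ.symm j, fun i => ?_, fun i a b hab => ?_, ?_⟩
  · exact sub_nonneg.2 (hu i.castSucc_le_succ)
  · simp only [Function.comp, indVec, mem_filter, mem_univ, true_and, Equiv.symm_apply_apply]
    split_ifs with h1 h2 <;> first | exact absurd (h1.trans hab) h2 | norm_num
  · ext j
    obtain ⟨k, rfl⟩ := τ.surjective j
    simp only [Pi.add_apply, Pi.smul_apply, Finset.sum_apply, indVec, mem_univ, if_true,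
      mem_filter, true_and, Equiv.symm_apply_apply, smul_eq_mul, mul_one, mul_ite, mul_zero]
    induction k using Fin.induction with
    | zero => simp
    | succ k ih =>
      have : ∀ i : Fin n, (if i.succ ≤ k.succ then u (τ i.succ) - u (τ i.castSucc) else 0) =
          (if i.succ ≤ k.castSucc then u (τ i.succ) - u (τ i.castSucc) else 0) +
          if i = k then u (τ k.succ) - u (τ k.castSucc) else 0 := fun i => by
        rcases lt_trichotomy i k with h | rfl | h
        · have h1 : i.succ ≤ k.castSucc := by rw [Fin.le_def]; simp; omega
          simp [h1, h.le, h.ne]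
        · simp [Fin.le_def]
        · have h1 : ¬ i.succ ≤ k.castSucc := by rw [Fin.le_def]; simp; omega
          simp [h1, h, h.ne']
      simp only [this, sum_add_distrib, sum_ite_eq', mem_univ, if_true, ← add_assoc, ← ih]
      ring

/-- Braid polytopes are determined by their support function on indicator vectors. -/
lemma IsBraidPolytope.eq_of_supp_indVec (hP : IsBraidPolytope P) (hQ : IsBraidPolytope Q)
    (h : ∀ S, supp P (indVec S) = supp Q (indVec S)) : P = Q := by
  refine eq_of_supp_eq hP.isPolytope hQ.isPolytope hP.nonempty hQ.nonempty fun u => ?_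
  cases d with
  | zero =>
    have : u = indVec ∅ := Subsingleton.elim _ _
    rw [this, h]
  | succ n =>
    obtain ⟨τ, hτ⟩ : ∃ τ : Equiv.Perm (Fin (n + 1)), Monotone (u ∘ τ) :=
      ⟨_, Tuple.monotone_sort u⟩
    obtain ⟨r, c, S, hc, hS, rfl⟩ := exists_sorted_decomposition τ u hτ
    have hconst : ∀ r : ℝ, Monotone ((r • indVec (univ : Finset (Fin (n + 1)))) ∘ τ) :=
      fun r a b _ => by simp [indVec]
    have hmono : ∀ i ∈ univ, Monotone ((c i • indVec (S i)) ∘ τ) :=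
      fun i _ a b hab => mul_le_mul_of_nonneg_left (hS i hab) (hc i)
    have key : ∀ {R : Set (Fin (n + 1) → ℝ)}, IsBraidPolytope R →
        supp R (r • indVec univ + ∑ i, c i • indVec (S i)) =
          r * supp R (indVec univ) + ∑ i, c i * supp R (indVec (S i)) := fun {R} hR => by
      obtain ⟨h1, h2⟩ := hR.supp_sum_of_sorted τ univ _ hmono
      rw [hR.supp_add_of_sorted τ _ _ (hconst r) h2, h1]
      simp only [fun i => supp_smul_right (hc i) R (indVec (S i))]
      congr 1
      rcases le_total 0 r with hr | hr
      · exact supp_smul_right hr _ _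
      · have h3 := hR.supp_add_of_sorted τ _ _ (hconst r) (hconst (-r))
        rw [← add_smul, add_neg_cancel, zero_smul, supp_zero_right,
          supp_smul_right (neg_nonneg.2 hr)] at h3
        linarith
    rw [key hP, key hQ]
    simp only [h]

lemma exists_common_sort (u v : Fin d → ℝ) (h : ∀ i j, u i < u j → v i ≤ v j)
    (h' : ∀ i j, v i < v j → u i ≤ u j) :
    ∃ τ : Equiv.Perm (Fin d), Monotone (u ∘ τ) ∧ Monotone (v ∘ τ) := by
  refine ⟨Tuple.sort (u + v), fun a b hab => ?_, fun a b hab => ?_⟩ <;>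
  · have h1 := Tuple.monotone_sort (u + v) hab
    simp only [Function.comp, Pi.add_apply] at h1 ⊢
    by_contra! h2
    first | linarith [h _ _ h2] | linarith [h' _ _ h2]

lemma exists_sort_indVec {S T : Finset (Fin d)} (hST : S ⊆ T) :
    ∃ τ : Equiv.Perm (Fin d), Monotone (indVec S ∘ τ) ∧ Monotone (indVec T ∘ τ) := by
  refine exists_common_sort _ _ (fun i j => ?_) fun i j => ?_ <;>
  · have h1 := @hST i
    have h2 := @hST j
    unfold indVec
    split_ifs <;> simp_all

lemma indVec_insert_add (S : Finset (Fin d)) {i j : Fin d} (hij : i ≠ j) :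
    indVec (insert i S) + indVec (insert j S) = indVec S + indVec (insert i (insert j S)) := by
  ext a
  simp only [Pi.add_apply, indVec, mem_insert]
  by_cases hai : a = i <;> by_cases haj : a = j <;> by_cases haS : a ∈ S <;> simp_all

lemma IsBraidPolytope.submodular (hP : IsBraidPolytope P) (S : Finset (Fin d)) {i j : Fin d}
    (hij : i ≠ j) : supp P (indVec S) + supp P (indVec (insert i (insert j S))) ≤
      supp P (indVec (insert i S)) + supp P (indVec (insert j S)) := by
  obtain ⟨τ, h1, h2⟩ := exists_sort_indVec
    ((subset_insert j S).trans (subset_insert i (insert j S)))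
  rw [← hP.supp_add_of_sorted τ _ _ h1 h2, ← indVec_insert_add S hij]
  exact supp_add_le hP.isPolytope hP.nonempty _ _

end Braid

/-- The convex hull of all rearrangements of the vector `a`. -/
def orbitPolytope {d : ℕ} (a : Fin d → ℝ) : Set (Fin d → ℝ) :=
  convexHull ℝ {x | ∃ σ : Equiv.Perm (Fin d), x = a ∘ σ}

section Orbit

variable {d : ℕ} {a b : Fin d → ℝ}

lemma permutahedron_eq_orbitPolytope :
    permutahedron d = orbitPolytope fun i => ((i : ℕ) + 1 : ℝ) := rfl

lemma isPolytope_orbitPolytope (a : Fin d → ℝ) : IsPolytope (orbitPolytope a) := by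
  refine isPolytope_convexHull ((Set.finite_range fun σ : Equiv.Perm (Fin d) => a ∘ σ).subset ?_)
  rintro _ ⟨σ, rfl⟩
  exact ⟨σ, rfl⟩

lemma orbitPolytope_nonempty (a : Fin d → ℝ) : (orbitPolytope a).Nonempty :=
  ⟨a, subset_convexHull ℝ _ ⟨1, rfl⟩⟩

lemma supp_orbitPolytope (ha : Monotone a) {τ : Equiv.Perm (Fin d)} {u : Fin d → ℝ}
    (hu : Monotone (u ∘ τ)) : supp (orbitPolytope a) u = (u ∘ τ) ⬝ᵥ a := by
  have h : u ⬝ᵥ (a ∘ τ.symm) = (u ∘ τ) ⬝ᵥ a := dotProduct_comp_equiv_symm u a τ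
  rw [← h]
  refine supp_convexHull_eq ⟨τ.symm, rfl⟩ ?_
  rintro _ ⟨σ, rfl⟩
  rw [h]
  calc u ⬝ᵥ (a ∘ σ) = ∑ i, (u ∘ τ) i * a ((τ.trans σ) i) :=
        (Equiv.sum_comp τ fun i => u i * a (σ i)).symm
    _ ≤ (u ∘ τ) ⬝ᵥ a := (hu.monovary ha).sum_mul_comp_perm_le_sum_mul

lemma isBraidPolytope_orbitPolytope (ha : Monotone a) : IsBraidPolytope (orbitPolytope a) where
  isPolytope := isPolytope_orbitPolytope a
  nonempty := orbitPolytope_nonempty a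
  supp_add_of_sorted τ u v hu hv := by
    rw [supp_orbitPolytope ha hu, supp_orbitPolytope ha hv, ← add_dotProduct]
    exact supp_orbitPolytope ha (hu.add hv)

lemma orbitPolytope_add (ha : Monotone a) (hb : Monotone b) :
    orbitPolytope a + orbitPolytope b = orbitPolytope (a + b) := by
  have hA := isPolytope_orbitPolytope a
  have hB := isPolytope_orbitPolytope b
  have hA' := orbitPolytope_nonempty a
  have hB' := orbitPolytope_nonempty b
  refine eq_of_supp_eq (hA.add hB) (isPolytope_orbitPolytope _) (hA'.add hB')
    (orbitPolytope_nonempty _) fun u => ?_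
  have hu := Tuple.monotone_sort u
  rw [supp_add hA hB hA' hB', supp_orbitPolytope ha hu, supp_orbitPolytope hb hu,
    ← dotProduct_add]
  exact (supp_orbitPolytope (ha.add hb) hu).symm

lemma orbitPolytope_smul (c : ℝ) (a : Fin d → ℝ) :
    orbitPolytope (c • a) = c • orbitPolytope a := by
  unfold orbitPolytope
  rw [← convexHull_smul]
  congr 1
  ext x
  simp only [Set.mem_ofPred_eq, Set.mem_smul_set]
  constructor
  · rintro ⟨σ, rfl⟩
    exact ⟨_, ⟨σ, rfl⟩, rfl⟩
  · rintro ⟨_, ⟨σ, rfl⟩, rfl⟩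
    exact ⟨σ, rfl⟩

lemma supp_orbitPolytope_indVec (ha : Monotone a) (S : Finset (Fin d)) :
    supp (orbitPolytope a) (indVec S) = ∑ i : Fin d, if d ≤ i + #S then a i else 0 := by
  obtain ⟨τ, hτ, -⟩ := exists_sort_indVec (Subset.refl S)
  rw [supp_orbitPolytope ha hτ]
  have hT : S.map τ.symm.toEmbedding = univ.filter fun i : Fin d => d ≤ i + #S := by
    have h1 : IsUpperSet ((S.map τ.symm.toEmbedding : Finset (Fin d)) : Set (Fin d)) := by
      intro i j hij hi
      have := hτ hij
      simp only [Function.comp, indVec] at this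
      simp only [mem_coe, mem_map_equiv, Equiv.symm_symm] at hi ⊢
      by_contra hj
      simp [hi, hj] at this
      linarith
    have h2 : IsUpperSet ((univ.filter fun i : Fin d => d ≤ i + #S : Finset (Fin d)) :
        Set (Fin d)) := by
      intro i j hij hi
      have : (i : ℕ) ≤ j := hij
      simp at hi ⊢
      omega
    have h3 : #(univ.filter fun i : Fin d => d ≤ i + #S) = #S := by
      have hS : #S ≤ d := by simpa using card_le_univ S
      have := Fin.card_filter_val_lt (n := d) (m := d - #S)
      have h4 := card_filter_add_card_filter_not (s := (univ : Finset (Fin d)))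
        (fun i : Fin d => (i : ℕ) < d - #S)
      have h5 : (univ.filter fun i : Fin d => ¬ (i : ℕ) < d - #S) =
        univ.filter fun i : Fin d => d ≤ i + #S := by ext i; simp
      rw [h5, this] at h4
      simp at h4
      omega
    rcases h1.total h2 with h | h
    · exact eq_of_subset_of_card_le (coe_subset.1 h) (by rw [h3, card_map])
    · exact (eq_of_subset_of_card_le (coe_subset.1 h) (by rw [h3, card_map])).symm
  refine sum_congr rfl fun i _ => ?_
  have h := Finset.ext_iff.1 hT i
  simp only [mem_map_equiv, Equiv.symm_symm, mem_filter, mem_univ, true_and] at h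
  simp [indVec, h]

end Orbit

section Simplex

variable {d : ℕ} {I : Finset (Fin d)}

lemma supp_stdSimp {u : Fin d → ℝ} {i : Fin d} (hi : i ∈ I) (h : ∀ j ∈ I, u j ≤ u i) :
    supp (stdSimp d I) u = u i := by
  have h' := supp_convexHull_eq (u := u)
    (Set.mem_image_of_mem (fun i => (Pi.single i 1 : Fin d → ℝ)) (mem_coe.2 hi)) (by
      rintro _ ⟨j, hj, rfl⟩
      simpa using h j hj)
  simpa [stdSimp] using h'

lemma isBraidPolytope_stdSimp (hI : I.Nonempty) : IsBraidPolytope (stdSimp d I) where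
  isPolytope := isPolytope_convexHull (I.finite_toSet.image _)
  nonempty := (hI.to_set.image _).convexHull
  supp_add_of_sorted τ u v hu hv := by
    obtain ⟨i, hi, hmax⟩ := I.exists_max_image τ.symm hI
    have key : ∀ {w : Fin d → ℝ}, Monotone (w ∘ τ) → ∀ j ∈ I, w j ≤ w i := fun hw j hj => by
      simpa using hw (hmax j hj)
    rw [supp_stdSimp hi (key hu), supp_stdSimp hi (key hv)]
    exact supp_stdSimp hi (key (hu.add hv))

lemma supp_stdSimp_indVec (hI : I.Nonempty) (S : Finset (Fin d)) :
    supp (stdSimp d I) (indVec S) = if Disjoint I S then 0 else 1 := by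
  split_ifs with h
  · obtain ⟨i, hi⟩ := hI
    have h0 : ∀ j ∈ I, indVec S j = 0 := fun j hj => if_neg (disjoint_left.1 h hj)
    rw [supp_stdSimp hi fun j hj => by rw [h0 i hi, h0 j hj], h0 i hi]
  · obtain ⟨i, hi, hiS⟩ := not_disjoint_iff.1 h
    have h1 : indVec S i = 1 := if_pos hiS
    rw [supp_stdSimp hi fun j _ => ?_, h1]
    rw [h1, indVec]
    split_ifs <;> norm_num

end Simplex

section GenPerm

variable {d : ℕ} {P Q : Set (Fin d → ℝ)}

lemma monotone_succ_cast : Monotone fun i : Fin d => ((i : ℕ) + 1 : ℝ) :=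
  fun i j hij => by
    have : ((i : ℕ) : ℝ) ≤ (j : ℕ) := by exact_mod_cast hij
    simpa using this

lemma isBraidPolytope_permutahedron : IsBraidPolytope (permutahedron d) :=
  isBraidPolytope_orbitPolytope monotone_succ_cast

lemma IsGenPerm.isBraidPolytope (hP : IsGenPerm P) : IsBraidPolytope P := by
  obtain ⟨hP, r, hr, Q, hQ, h⟩ := hP
  exact .of_add hP hQ (h ▸ isBraidPolytope_permutahedron.smul hr.le)

lemma isGenPerm_singleton_zero : IsGenPerm ({0} : Set (Fin d → ℝ)) :=
  ⟨isPolytope_singleton 0, 1, one_pos, permutahedron d,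
    isBraidPolytope_permutahedron.isPolytope, by simp⟩

lemma IsGenPerm.add (hP : IsGenPerm P) (hQ : IsGenPerm Q) : IsGenPerm (P + Q) := by
  obtain ⟨hP, r, hr, P', hP', h⟩ := hP
  obtain ⟨hQ, s, hs, Q', hQ', h'⟩ := hQ
  refine ⟨hP.add hQ, r + s, add_pos hr hs, P' + Q', hP'.add hQ', ?_⟩
  rw [add_add_add_comm, h, h',
    isBraidPolytope_permutahedron.isPolytope.convex.add_smul hr.le hs.le]

lemma IsGenPerm.smul (hP : IsGenPerm P) {c : ℝ} (hc : 0 ≤ c) : IsGenPerm (c • P) := by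
  rcases hc.eq_or_lt with rfl | hc
  · rw [Set.zero_smul_set hP.isBraidPolytope.nonempty]
    exact isGenPerm_singleton_zero
  obtain ⟨hP, r, hr, Q, hQ, h⟩ := hP
  exact ⟨hP.smul c, c * r, mul_pos hc hr, c • Q, hQ.smul c, by rw [← smul_add, h, mul_smul]⟩

lemma IsGenPerm.image_perm (hP : IsGenPerm P) (σ : Equiv.Perm (Fin d)) :
    IsGenPerm ((fun x : Fin d → ℝ => fun a => x (σ a)) '' P) := by
  obtain ⟨hP, r, hr, Q, hQ, h⟩ := hP
  refine ⟨hP.image (LinearMap.funLeft ℝ ℝ σ), r, hr, LinearMap.funLeft ℝ ℝ σ '' Q,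
    hQ.image _, ?_⟩
  have h1 : LinearMap.funLeft ℝ ℝ σ '' (P + Q) =
      LinearMap.funLeft ℝ ℝ σ '' P + LinearMap.funLeft ℝ ℝ σ '' Q := Set.image_add _
  refine h1.symm.trans ?_
  rw [h, image_smul_set, permutahedron, LinearMap.image_convexHull]
  congr 2
  ext x
  constructor
  · rintro ⟨_, ⟨ρ, rfl⟩, rfl⟩
    exact ⟨σ.trans ρ, rfl⟩
  · rintro ⟨ρ, rfl⟩
    exact ⟨_, ⟨σ.symm.trans ρ, rfl⟩, by ext i; simp [LinearMap.funLeft]⟩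

lemma IsGenPerm.add_singleton (hP : IsGenPerm P) (t : Fin d → ℝ) : IsGenPerm (P + {t}) := by
  obtain ⟨hP, r, hr, Q, hQ, h⟩ := hP
  refine ⟨hP.add (isPolytope_singleton t), r, hr, Q + {-t}, hQ.add (isPolytope_singleton _), ?_⟩
  rw [add_add_add_comm, h]
  simp

lemma exists_orbitPolytope_add_eq {a : Fin d → ℝ} (ha : Monotone a) :
    ∃ r : ℝ, 0 < r ∧ ∃ Q : Set (Fin d → ℝ), IsBraidPolytope Q ∧
      orbitPolytope a + Q = r • permutahedron d := by
  set r : ℝ := 1 + 2 * ∑ i, |a i| with hr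
  have hr0 : 0 < r := by positivity
  have hb : Monotone (r • (fun i : Fin d => ((i : ℕ) + 1 : ℝ)) - a) := by
    intro i j hij
    rcases hij.eq_or_lt with rfl | hij
    · rfl
    have h1 : ((i : ℕ) : ℝ) + 1 ≤ (j : ℕ) := by exact_mod_cast hij
    have h2 : ∀ i, |a i| ≤ ∑ i, |a i| :=
      fun i => single_le_sum (fun j _ => abs_nonneg (a j)) (mem_univ i)
    simp only [Pi.sub_apply, Pi.smul_apply, smul_eq_mul]
    nlinarith [h2 i, h2 j, neg_abs_le (a i), le_abs_self (a j)]
  refine ⟨r, hr0, _, isBraidPolytope_orbitPolytope hb, ?_⟩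
  rw [orbitPolytope_add ha hb, add_sub_cancel, orbitPolytope_smul,
    permutahedron_eq_orbitPolytope]

lemma isGenPerm_orbitPolytope {a : Fin d → ℝ} (ha : Monotone a) :
    IsGenPerm (orbitPolytope a) := by
  obtain ⟨r, hr, Q, hQ, h⟩ := exists_orbitPolytope_add_eq ha
  exact ⟨isPolytope_orbitPolytope a, r, hr, Q, hQ.isPolytope, h⟩

lemma sum_stdSimp_eq_orbitPolytope :
    ∑ I : Finset (Fin d) with I.Nonempty, stdSimp d I =
      orbitPolytope fun i => (2 : ℝ) ^ (i : ℕ) := by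
  have hmono : Monotone fun i : Fin d => (2 : ℝ) ^ (i : ℕ) :=
    fun i j hij => pow_le_pow_right₀ one_le_two hij
  have hbr : ∀ I ∈ univ.filter fun I : Finset (Fin d) => I.Nonempty,
      IsBraidPolytope (stdSimp d I) := fun I hI => isBraidPolytope_stdSimp (mem_filter.1 hI).2
  refine (isBraidPolytope_sum hbr).eq_of_supp_indVec (isBraidPolytope_orbitPolytope hmono)
    fun S => ?_
  have hS : #S ≤ d := by simpa using card_le_univ S
  rw [supp_sum hbr, supp_orbitPolytope_indVec hmono,
    sum_congr rfl fun I hI => supp_stdSimp_indVec (mem_filter.1 hI).2 S]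
  have h1 : ∑ I : Finset (Fin d) with I.Nonempty, (if Disjoint I S then (0 : ℝ) else 1) =
      ∑ I : Finset (Fin d), (1 - if I ∈ Sᶜ.powerset then (1 : ℝ) else 0) := by
    rw [sum_filter]
    refine sum_congr rfl fun I _ => ?_
    have : Disjoint I S ↔ I ⊆ Sᶜ := subset_compl_iff_disjoint_right.symm
    rcases I.eq_empty_or_nonempty with rfl | hI
    · simp
    · by_cases h : I ⊆ Sᶜ <;> simp [this, h, hI]
  have h2 : ∑ i : Fin d, (if d ≤ i + #S then (2 : ℝ) ^ (i : ℕ) else 0) =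
      ∑ i ∈ range d, (2 : ℝ) ^ i - ∑ i ∈ range (d - #S), (2 : ℝ) ^ i := by
    rw [Fin.sum_univ_eq_sum_range fun i => if d ≤ i + #S then (2 : ℝ) ^ i else 0, ← sum_filter,
      eq_sub_iff_add_eq, ← sum_filter_add_sum_filter_not (range d) (fun i => d ≤ i + #S)]
    congr 1
    refine sum_congr ?_ fun _ _ => rfl
    ext i
    simp
    omega
  rw [h1, h2, sum_sub_distrib, geom_sum_eq (by norm_num), geom_sum_eq (by norm_num),
    sum_ite_mem, univ_inter, sum_const, sum_const, card_powerset, card_compl]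
  simp
  norm_num

lemma isGenPerm_stdSimp {I : Finset (Fin d)} (hI : I.Nonempty) : IsGenPerm (stdSimp d I) := by
  obtain ⟨r, hr, Q, hQ, h⟩ := exists_orbitPolytope_add_eq (a := fun i : Fin d => (2 : ℝ) ^ (i : ℕ))
    fun i j hij => pow_le_pow_right₀ one_le_two hij
  rw [← sum_stdSimp_eq_orbitPolytope,
    ← add_sum_erase _ _ (mem_filter.2 ⟨mem_univ I, hI⟩), add_assoc] at h
  refine ⟨(isBraidPolytope_stdSimp hI).isPolytope, r, hr, _,
    IsPolytope.add (isBraidPolytope_sum fun J hJ => ?_).isPolytope hQ.isPolytope, h⟩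
  exact isBraidPolytope_stdSimp (mem_filter.1 (mem_of_mem_erase hJ)).2

end GenPerm

section MinkowskiLinear

variable {d : ℕ}

/-- `φ` is additive and positively homogeneous on generalized permutahedra. -/
def IsMinkowskiLinear (φ : Set (Fin d → ℝ) → ℝ) : Prop :=
  ∀ P Q : Set (Fin d → ℝ), IsGenPerm P → IsGenPerm Q → ∀ lam mu : ℝ,
    0 ≤ lam → 0 ≤ mu → φ (lam • P + mu • Q) = lam * φ P + mu * φ Q

variable {φ ψ : Set (Fin d → ℝ) → ℝ} {P Q : Set (Fin d → ℝ)}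

lemma IsMinkowskiLinear.map_add (hφ : IsMinkowskiLinear φ) (hP : IsGenPerm P)
    (hQ : IsGenPerm Q) : φ (P + Q) = φ P + φ Q := by
  simpa using hφ P Q hP hQ 1 1 zero_le_one zero_le_one

lemma IsMinkowskiLinear.map_singleton_zero (hφ : IsMinkowskiLinear φ) : φ {0} = 0 := by
  simpa using hφ.map_add (isGenPerm_singleton_zero (d := d)) isGenPerm_singleton_zero

lemma IsMinkowskiLinear.map_smul (hφ : IsMinkowskiLinear φ) (hP : IsGenPerm P) {c : ℝ}
    (hc : 0 ≤ c) : φ (c • P) = c * φ P := by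
  have h := hφ P P hP hP c 0 hc le_rfl
  rw [Set.zero_smul_set hP.isBraidPolytope.nonempty] at h
  simpa using h

lemma isGenPerm_sum {ι : Type*} {s : Finset ι} {F : ι → Set (Fin d → ℝ)}
    (hF : ∀ i ∈ s, IsGenPerm (F i)) : IsGenPerm (∑ i ∈ s, F i) :=
  Finset.sum_induction F IsGenPerm (fun _ _ => .add) isGenPerm_singleton_zero hF

lemma IsMinkowskiLinear.map_sum (hφ : IsMinkowskiLinear φ) {ι : Type*} {s : Finset ι}
    {F : ι → Set (Fin d → ℝ)} (hF : ∀ i ∈ s, IsGenPerm (F i)) :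
    φ (∑ i ∈ s, F i) = ∑ i ∈ s, φ (F i) := by
  classical
  induction s using Finset.induction_on with
  | empty => exact hφ.map_singleton_zero
  | insert a s ha ih =>
    have h2 : ∀ i ∈ s, IsGenPerm (F i) := fun i hi => hF i (mem_insert_of_mem hi)
    rw [sum_insert ha, sum_insert ha,
      hφ.map_add (hF a (mem_insert_self a s)) (isGenPerm_sum h2), ih h2]

lemma exists_sum_powerset_eq {α : Type*} [DecidableEq α] (w : Finset α → ℝ) :
    ∃ y : Finset α → ℝ, ∀ T, ∑ I ∈ T.powerset, y I = w T := by
  let y : Finset α → ℝ := Finset.strongInduction fun T rec =>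
    w T - ∑ I ∈ T.ssubsets.attach, rec I.1 (mem_ssubsets.1 I.2)
  refine ⟨y, fun T => ?_⟩
  have hy : y T = w T - ∑ I ∈ T.ssubsets, y I := by
    rw [← sum_attach T.ssubsets y]
    exact Finset.strongInduction_eq _ T
  have hT : T.powerset = insert T T.ssubsets := by
    rw [ssubsets, insert_erase (mem_powerset_self T)]
  rw [hT, sum_insert (by simp), hy, sub_add_cancel]

/-- Every generalized permutahedron is a signed Minkowski sum of standard simplices. -/
lemma IsGenPerm.exists_add_sum_stdSimp_eq (hP : IsGenPerm P) :
    ∃ a b : Finset (Fin d) → ℝ, (∀ I, 0 ≤ a I) ∧ (∀ I, 0 ≤ b I) ∧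
      P + ∑ I : Finset (Fin d) with I.Nonempty, a I • stdSimp d I =
        ∑ I : Finset (Fin d) with I.Nonempty, b I • stdSimp d I := by
  obtain ⟨y, hy⟩ := exists_sum_powerset_eq fun T : Finset (Fin d) =>
    supp P (indVec univ) - supp P (indVec Tᶜ)
  refine ⟨fun I => (y I)⁻, fun I => (y I)⁺, fun I => negPart_nonneg _,
    fun I => posPart_nonneg _, ?_⟩
  have hbr : ∀ {c : Finset (Fin d) → ℝ}, (∀ I, 0 ≤ c I) →
      ∀ I ∈ univ.filter fun I : Finset (Fin d) => I.Nonempty,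
        IsBraidPolytope (c I • stdSimp d I) := fun hc I hI =>
    (isBraidPolytope_stdSimp (mem_filter.1 hI).2).smul (hc I)
  have ha := hbr (c := fun I => (y I)⁻) fun I => negPart_nonneg _
  have hb := hbr (c := fun I => (y I)⁺) fun I => posPart_nonneg _
  have hA := isBraidPolytope_sum ha
  have hPb := hP.isBraidPolytope
  refine (hPb.add hA).eq_of_supp_indVec (isBraidPolytope_sum hb) fun S => ?_
  rw [supp_add hPb.isPolytope hA.isPolytope hPb.nonempty hA.nonempty, supp_sum ha, supp_sum hb,
    ← eq_sub_iff_add_eq, ← sum_sub_distrib]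
  have h0 : indVec (∅ : Finset (Fin d)) = 0 := by ext; simp [indVec]
  have hyempty : y ∅ = 0 := by simpa using hy ∅
  have h1 : ∀ I ∈ univ.filter fun I : Finset (Fin d) => I.Nonempty,
      supp ((y I)⁺ • stdSimp d I) (indVec S) - supp ((y I)⁻ • stdSimp d I) (indVec S) =
        y I - if I ∈ Sᶜ.powerset then y I else 0 := fun I hI => by
    rw [supp_smul (posPart_nonneg _), supp_smul (negPart_nonneg _),
      supp_stdSimp_indVec (mem_filter.1 hI).2, ← sub_mul, posPart_sub_negPart]
    have : I ∈ Sᶜ.powerset ↔ Disjoint I S := by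
      rw [mem_powerset, subset_compl_iff_disjoint_right]
    by_cases h : Disjoint I S <;> simp only [this, h, if_true, if_false] <;> simp
  rw [sum_congr rfl h1, sum_filter_of_ne fun I _ hI => ?_, sum_sub_distrib, sum_ite_mem,
    univ_inter, hy, ← powerset_univ, hy]
  · simp [h0, supp_zero_right]
  · rw [nonempty_iff_ne_empty]
    rintro rfl
    simp [hyempty] at hI

/-- Minkowski linear functionals are determined by their values on standard simplices. -/
lemma IsMinkowskiLinear.ext (hφ : IsMinkowskiLinear φ) (hψ : IsMinkowskiLinear ψ)
    (h : ∀ I : Finset (Fin d), I.Nonempty → φ (stdSimp d I) = ψ (stdSimp d I))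
    (hP : IsGenPerm P) : φ P = ψ P := by
  obtain ⟨a, b, ha, hb, hab⟩ := hP.exists_add_sum_stdSimp_eq
  have hgp : ∀ {c : Finset (Fin d) → ℝ}, (∀ I, 0 ≤ c I) →
      ∀ I ∈ univ.filter fun I : Finset (Fin d) => I.Nonempty,
        IsGenPerm (c I • stdSimp d I) := fun hc I hI =>
    (isGenPerm_stdSimp (mem_filter.1 hI).2).smul (hc I)
  have key : ∀ {χ : Set (Fin d → ℝ) → ℝ}, IsMinkowskiLinear χ →
      χ P + ∑ I : Finset (Fin d) with I.Nonempty, a I * χ (stdSimp d I) =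
        ∑ I : Finset (Fin d) with I.Nonempty, b I * χ (stdSimp d I) := fun {χ} hχ => by
    have h1 := congrArg χ hab
    rw [hχ.map_add hP (isGenPerm_sum (hgp ha)), hχ.map_sum (hgp ha), hχ.map_sum (hgp hb)] at h1
    have h2 : ∀ {c : Finset (Fin d) → ℝ}, (∀ I, 0 ≤ c I) →
        ∑ I : Finset (Fin d) with I.Nonempty, χ (c I • stdSimp d I) =
          ∑ I : Finset (Fin d) with I.Nonempty, c I * χ (stdSimp d I) := fun hc =>
      sum_congr rfl fun I hI => hχ.map_smul (isGenPerm_stdSimp (mem_filter.1 hI).2) (hc I)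
    rwa [h2 ha, h2 hb] at h1
  have hcongr : ∀ c : Finset (Fin d) → ℝ,
      ∑ I : Finset (Fin d) with I.Nonempty, c I * φ (stdSimp d I) =
        ∑ I : Finset (Fin d) with I.Nonempty, c I * ψ (stdSimp d I) := fun c =>
    sum_congr rfl fun I hI => by rw [h I (mem_filter.1 hI).2]
  have h1 := key hφ
  rw [hcongr, hcongr] at h1
  linarith [key hψ]

end MinkowskiLinear

/-- The submodularity defect of the support function of `P` at `S`, `S ∪ {i}`, `S ∪ {j}`. -/
noncomputable def defect {d : ℕ} (P : Set (Fin d → ℝ)) (S : Finset (Fin d)) (i j : Fin d) : ℝ :=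
  supp P (indVec (insert i S)) + supp P (indVec (insert j S)) - supp P (indVec S) -
    supp P (indVec (insert i (insert j S)))

/-- The sum of the submodularity defects of `P` over all sets of size `d - 1 - k`. -/
noncomputable def totalDefect {d : ℕ} (k : ℕ) (P : Set (Fin d → ℝ)) : ℝ :=
  (∑ S ∈ powersetCard (d - 1 - k) univ, ∑ p ∈ (univ : Finset (Fin d)).offDiag,
    defect P S p.1 p.2) / 2

section Defect

variable {d : ℕ} {P : Set (Fin d → ℝ)}

lemma isMinkowskiLinear_totalDefect (k : ℕ) :
    IsMinkowskiLinear (totalDefect k : Set (Fin d → ℝ) → ℝ) := by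
  intro P Q hP hQ r s hr hs
  have hsupp : ∀ u, supp (r • P + s • Q) u = r * supp P u + s * supp Q u := fun u => by
    have h1 := hP.isBraidPolytope.smul hr
    have h2 := hQ.isBraidPolytope.smul hs
    rw [supp_add h1.isPolytope h2.isPolytope h1.nonempty h2.nonempty, supp_smul hr, supp_smul hs]
  have hdef : ∀ S i j, defect (r • P + s • Q) S i j = r * defect P S i j + s * defect Q S i j :=
    fun S i j => by
      simp only [defect, hsupp]
      ring
  simp only [totalDefect, hdef, sum_add_distrib, ← mul_sum]
  ring

lemma IsGenPerm.totalDefect_nonneg (hP : IsGenPerm P) (k : ℕ) : 0 ≤ totalDefect k P := by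
  refine div_nonneg (sum_nonneg fun S _ => sum_nonneg fun p hp => ?_) zero_le_two
  have := hP.isBraidPolytope.submodular S (mem_offDiag.1 hp).2.2
  unfold defect
  linarith

lemma IsGenPerm.totalDefect_add_singleton (hP : IsGenPerm P) (k : ℕ) (t : Fin d → ℝ) :
    totalDefect k (P + {t}) = totalDefect k P := by
  unfold totalDefect
  congr 1
  refine sum_congr rfl fun S _ => sum_congr rfl fun p hp => ?_
  have h := congrArg (· ⬝ᵥ t) (indVec_insert_add S (mem_offDiag.1 hp).2.2)
  simp only [add_dotProduct] at h
  simp only [defect, supp_add hP.isBraidPolytope.isPolytope (isPolytope_singleton t)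
    hP.isBraidPolytope.nonempty (Set.singleton_nonempty t), supp_singleton]
  linarith

lemma totalDefect_image_perm (k : ℕ) (P : Set (Fin d → ℝ)) (σ : Equiv.Perm (Fin d)) :
    totalDefect k ((fun x : Fin d → ℝ => fun a => x (σ a)) '' P) = totalDefect k P := by
  have hind : ∀ S : Finset (Fin d), indVec S ∘ σ.symm = indVec (S.map σ.toEmbedding) := fun S => by
    ext i
    simp [indVec]
  unfold totalDefect
  congr 1
  refine sum_equiv σ.finsetCongr (by simp [mem_powersetCard]) fun S _ =>
    sum_equiv (σ.prodCongr σ) (by simp) fun p _ => ?_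
  simp [defect, supp_image_perm, hind, map_insert]

lemma totalDefect_stdSimp {I : Finset (Fin d)} (hI : I.Nonempty) {k : ℕ}
    (hk : k ∈ Icc 1 (d - 1)) : totalDefect k (stdSimp d I) = fval d k #I := by
  rw [mem_Icc] at hk
  have hId : #I ≤ d := by simpa using card_le_univ I
  have h1 : ∀ S, ∀ p ∈ (univ : Finset (Fin d)).offDiag, defect (stdSimp d I) S p.1 p.2 =
      if p ∈ I.offDiag then (if Disjoint I S then 1 else 0) else 0 := fun S p hp => by
    simp only [defect, supp_stdSimp_indVec hI, disjoint_insert_right, mem_offDiag]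
    split_ifs <;> simp_all
  have h2 : univ.offDiag ∩ I.offDiag = I.offDiag :=
    inter_eq_right.2 (offDiag_mono (subset_univ I))
  have h3 : (powersetCard (d - 1 - k) univ).filter (fun S => Disjoint I S) =
      powersetCard (d - 1 - k) Iᶜ := by
    ext S
    simp [mem_powersetCard, subset_compl_iff_disjoint_left, and_comm]
  unfold totalDefect
  rw [sum_congr rfl fun S _ => sum_congr rfl (h1 S)]
  simp only [sum_ite_mem, h2, sum_const, offDiag_card]
  rw [← smul_sum, sum_boole, h3, card_powersetCard, card_compl, Fintype.card_fin, fval,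
    Nat.cast_choose_two, nsmul_eq_mul, Nat.cast_sub (Nat.le_mul_self _)]
  have h4 : (d - #I).choose (d - 1 - k) =
      if #I ≤ k + 1 then (d - #I).choose (k + 1 - #I) else 0 := by
    split_ifs with h
    · rw [← Nat.choose_symm (by omega)]
      congr 1
      omega
    · exact Nat.choose_eq_zero_of_lt (by omega)
  rw [h4]
  push_cast
  ring

/-- The hypersimplex whose vertices are the `0/1` vectors with `d - k` ones. -/
def hypersimplex (d k : ℕ) : Set (Fin d → ℝ) :=
  orbitPolytope fun i => if k ≤ (i : ℕ) then 1 else 0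

lemma monotone_threshold (k : ℕ) :
    Monotone fun i : Fin d => if k ≤ (i : ℕ) then (1 : ℝ) else 0 := fun i j hij => by
  have : (i : ℕ) ≤ j := hij
  dsimp only
  split_ifs
  · rfl
  · omega
  · norm_num
  · rfl

lemma isGenPerm_hypersimplex (k : ℕ) : IsGenPerm (hypersimplex d k) :=
  isGenPerm_orbitPolytope (monotone_threshold k)

lemma supp_hypersimplex_indVec (k : ℕ) (S : Finset (Fin d)) :
    supp (hypersimplex d k) (indVec S) = ((d - max (d - #S) k : ℕ) : ℝ) := by
  rw [hypersimplex, supp_orbitPolytope_indVec (monotone_threshold k),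
    Fin.sum_univ_eq_sum_range
      fun i => if d ≤ i + #S then (if k ≤ i then (1 : ℝ) else 0) else 0]
  simp only [← ite_and]
  rw [sum_boole, ← Nat.card_Ico]
  congr 2
  ext i
  simp
  omega

lemma defect_hypersimplex {k k' : ℕ} (hk : k ∈ Icc 1 (d - 1)) (hk' : k' ∈ Icc 1 (d - 1))
    {S : Finset (Fin d)} (hS : #S = d - 1 - k) {i j : Fin d} (hij : i ≠ j) :
    defect (hypersimplex d k') S i j = if i ∉ S ∧ j ∉ S ∧ k = k' then 1 else 0 := by
  rw [mem_Icc] at hk hk'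
  unfold defect
  by_cases hi : i ∈ S
  · simp [hi]
  by_cases hj : j ∈ S
  · simp [hj]
  have hi' : i ∉ insert j S := by simp [hi, hij]
  simp only [supp_hypersimplex_indVec, card_insert_of_notMem hi, card_insert_of_notMem hj,
    card_insert_of_notMem hi', hS, hi, hj, not_false_eq_true, true_and]
  rw [sub_sub, sub_eq_iff_eq_add]
  split_ifs with h
  · norm_cast
    omega
  · rw [zero_add]
    norm_cast
    omega

lemma totalDefect_hypersimplex_of_ne {k k' : ℕ} (hk : k ∈ Icc 1 (d - 1))
    (hk' : k' ∈ Icc 1 (d - 1)) (h : k ≠ k') : totalDefect k (hypersimplex d k') = 0 := by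
  unfold totalDefect
  rw [sum_eq_zero fun S hS => sum_eq_zero fun p hp => ?_, zero_div]
  rw [defect_hypersimplex hk hk' (mem_powersetCard.1 hS).2 (mem_offDiag.1 hp).2.2]
  simp [h]

lemma totalDefect_hypersimplex_pos {k : ℕ} (hk : k ∈ Icc 1 (d - 1)) :
    0 < totalDefect k (hypersimplex d k) := by
  have hval : ∀ S ∈ powersetCard (d - 1 - k) (univ : Finset (Fin d)),
      ∀ p ∈ (univ : Finset (Fin d)).offDiag, defect (hypersimplex d k) S p.1 p.2 =
        if p.1 ∉ S ∧ p.2 ∉ S ∧ k = k then 1 else 0 := fun S hS p hp =>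
    defect_hypersimplex hk hk (mem_powersetCard.1 hS).2 (mem_offDiag.1 hp).2.2
  obtain ⟨S, hS⟩ : (powersetCard (d - 1 - k) (univ : Finset (Fin d))).Nonempty :=
    powersetCard_nonempty.2 (by simp; omega)
  have hcard : 1 < #Sᶜ := by
    rw [card_compl, (mem_powersetCard.1 hS).2, Fintype.card_fin]
    rw [mem_Icc] at hk
    omega
  obtain ⟨i, hi, j, hj, hij⟩ := one_lt_card.1 hcard
  have hp : (i, j) ∈ (univ : Finset (Fin d)).offDiag := by simp [hij]
  unfold totalDefect
  rw [sum_congr rfl fun S hS => sum_congr rfl (hval S hS)]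
  refine div_pos (sum_pos' (fun T _ => sum_nonneg fun p _ => ?_) ⟨S, hS, ?_⟩) two_pos
  · split_ifs <;> norm_num
  · refine sum_pos' (fun p _ => ?_) ⟨_, hp, ?_⟩
    · split_ifs <;> norm_num
    · simp [mem_compl.1 hi, mem_compl.1 hj]

end Defect

lemma eq_zero_of_sum_mul_fval_eq_zero {d : ℕ} {c : ℕ → ℝ}
    (h : ∀ m ∈ Icc 2 d, ∑ k ∈ Icc 1 (d - 1), c k * fval d k m = 0) :
    ∀ k ∈ Icc 1 (d - 1), c k = 0 := by
  suffices H : ∀ n, ∀ k ∈ Icc 1 (d - 1), d - k = n → c k = 0 from fun k hk => H _ k hk rfl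
  intro n
  induction n using Nat.strong_induction_on with
  | _ n ih =>
    rintro k hk rfl
    have hk' := mem_Icc.1 hk
    have h1 := h (k + 1) (by rw [mem_Icc]; omega)
    rw [sum_eq_single_of_mem k hk fun j hj hjk => ?_] at h1
    · have h2 : fval d k (k + 1) ≠ 0 := by
        have : (k + 1).choose 2 ≠ 0 := (Nat.choose_pos (by omega)).ne'
        simpa [fval] using this
      exact (mul_eq_zero.1 h1).resolve_right h2
    · have hj' := mem_Icc.1 hj
      rcases lt_or_gt_of_ne hjk with hlt | hlt
      · rw [fval, if_neg (by omega), mul_zero, mul_zero]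
      · rw [ih (d - j) (by omega) j hj rfl, zero_mul]

lemma exists_sum_mul_fval_eq (d : ℕ) (g : ℕ → ℝ) :
    ∃ c : ℕ → ℝ, ∀ m ∈ Icc 2 d, ∑ k ∈ Icc 1 (d - 1), c k * fval d k m = g m := by
  let M : Matrix (Icc 1 (d - 1)) (Icc 1 (d - 1)) ℝ := Matrix.of fun k j => fval d j (k + 1)
  let ext : (Icc 1 (d - 1) → ℝ) → ℕ → ℝ := fun x k =>
    if hk : k ∈ Icc 1 (d - 1) then x ⟨k, hk⟩ else 0
  have hM : ∀ (x : Icc 1 (d - 1) → ℝ) k,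
      M.mulVecLin x k = ∑ j ∈ Icc 1 (d - 1), ext x j * fval d j (k + 1) := fun x k => by
    rw [← sum_coe_sort (Icc 1 (d - 1)) fun j => ext x j * fval d j (k + 1)]
    rw [Matrix.mulVecLin_apply, Matrix.mulVec, dotProduct]
    refine sum_congr rfl fun j _ => ?_
    simp only [ext, dif_pos j.2]
    exact mul_comm _ _
  have hinj : Function.Injective M.mulVecLin := by
    refine (injective_iff_map_eq_zero _).2 fun x hx => funext fun k => ?_
    have := eq_zero_of_sum_mul_fval_eq_zero (c := ext x) (fun m hm => ?_) k k.2
    · rwa [show ext x k = x k from dif_pos k.2] at this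
    · have hm' := mem_Icc.1 hm
      have h1 := hM x ⟨m - 1, by rw [mem_Icc]; omega⟩
      rw [hx, Nat.sub_add_cancel (by omega)] at h1
      exact h1.symm
  obtain ⟨x, hx⟩ := LinearMap.injective_iff_surjective.1 hinj fun k => g (k + 1)
  refine ⟨ext x, fun m hm => ?_⟩
  have hm' := mem_Icc.1 hm
  have h1 := hM x ⟨m - 1, by rw [mem_Icc]; omega⟩
  rw [hx] at h1
  simp only [Nat.sub_add_cancel (show 1 ≤ m by omega)] at h1
  exact h1.symm

lemma exists_perm_image_stdSimp {d : ℕ} {I J : Finset (Fin d)} (h : #I = #J) :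
    ∃ σ : Equiv.Perm (Fin d),
      (fun x : Fin d → ℝ => fun a => x (σ a)) '' stdSimp d I = stdSimp d J := by
  let σ : Equiv.Perm (Fin d) := (equivOfCardEq h).extendSubtype
  have hσ : J = I.map σ.toEmbedding := by
    refine (eq_of_subset_of_card_le (fun j hj => ?_) (by rw [card_map, h])).symm
    obtain ⟨i, hi, rfl⟩ := mem_map.1 hj
    exact (equivOfCardEq h).extendSubtype_mem i hi
  refine ⟨σ.symm, ?_⟩
  have h1 := LinearMap.image_convexHull (LinearMap.funLeft ℝ ℝ σ.symm)
    ((fun i => (Pi.single i 1 : Fin d → ℝ)) '' (I : Set (Fin d)))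
  refine h1.trans ?_
  rw [stdSimp, hσ, Set.image_image, coe_map, Set.image_image]
  congr 1
  refine Set.image_congr fun i _ => ?_
  ext a
  simp [LinearMap.funLeft, Pi.single_apply, Equiv.symm_apply_eq]

lemma stdSimp_singleton {d : ℕ} (i : Fin d) : stdSimp d {i} = {Pi.single i 1} := by
  simp [stdSimp]

lemma isMinkowskiLinear_sum_totalDefect {d : ℕ} (c : ℕ → ℝ) :
    IsMinkowskiLinear fun P : Set (Fin d → ℝ) =>
      ∑ k ∈ Icc 1 (d - 1), c k * totalDefect k P := by
  intro P Q hP hQ r s hr hs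
  simp only [isMinkowskiLinear_totalDefect _ P Q hP hQ r s hr hs, mul_sum, ← sum_add_distrib]
  exact sum_congr rfl fun k _ => by ring

lemma IsMinkowskiLinear.eq_sum_totalDefect {d : ℕ} {φ : Set (Fin d → ℝ) → ℝ}
    (hφ : IsMinkowskiLinear φ) {c : ℕ → ℝ}
    (h : ∀ I : Finset (Fin d), I.Nonempty →
      φ (stdSimp d I) = ∑ k ∈ Icc 1 (d - 1), c k * fval d k I.card)
    {P : Set (Fin d → ℝ)} (hP : IsGenPerm P) :
    φ P = ∑ k ∈ Icc 1 (d - 1), c k * totalDefect k P := by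
  refine hφ.ext (isMinkowskiLinear_sum_totalDefect c) (fun I hI => ?_) hP
  rw [h I hI]
  exact sum_congr rfl fun k hk => by rw [totalDefect_stdSimp hI hk]

theorem stmt5 (d : ℕ) (hd : 2 ≤ d) (φ : Set (Fin d → ℝ) → ℝ)
    (hφ0 : φ ∅ = 0)
    (hlin : ∀ P Q : Set (Fin d → ℝ), IsGenPerm P → IsGenPerm Q → ∀ lam mu : ℝ,
      0 ≤ lam → 0 ≤ mu → φ (lam • P + mu • Q) = lam * φ P + mu * φ Q) :
    (((∀ P : Set (Fin d → ℝ), IsGenPerm P → 0 ≤ φ P) ∧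
        (∀ (P : Set (Fin d → ℝ)) (t : Fin d → ℝ), IsGenPerm P → φ (P + {t}) = φ P) ∧
        (∀ (P : Set (Fin d → ℝ)) (σ : Equiv.Perm (Fin d)), IsGenPerm P →
          φ ((fun x : Fin d → ℝ => fun a => x (σ a)) '' P) = φ P))
      ↔ (∃ c : ℕ → ℝ, (∀ k ∈ Icc 1 (d - 1), 0 ≤ c k) ∧
          ∀ I : Finset (Fin d), I.Nonempty →
            φ (stdSimp d I) = ∑ k ∈ Icc 1 (d - 1), c k * fval d k I.card))
    ∧ (∀ c c' : ℕ → ℝ,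
        (∀ I : Finset (Fin d), I.Nonempty →
          φ (stdSimp d I) = ∑ k ∈ Icc 1 (d - 1), c k * fval d k I.card) →
        (∀ I : Finset (Fin d), I.Nonempty →
          φ (stdSimp d I) = ∑ k ∈ Icc 1 (d - 1), c' k * fval d k I.card) →
        ∀ k ∈ Icc 1 (d - 1), c k = c' k) := by
  have hφ : IsMinkowskiLinear φ := hlin
  have hcard : ∀ m ≤ d, ∃ I : Finset (Fin d), #I = m := fun m hm => by
    obtain ⟨I, -, hI⟩ := exists_subset_card_eq (s := (univ : Finset (Fin d))) (n := m) (by simpa)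
    exact ⟨I, hI⟩
  refine ⟨⟨?_, ?_⟩, ?_⟩
  · rintro ⟨hnonneg, htrans, hperm⟩
    have hcongr : ∀ I J : Finset (Fin d), I.Nonempty → #I = #J →
        φ (stdSimp d I) = φ (stdSimp d J) := fun I J hI h => by
      obtain ⟨σ, hσ⟩ := exists_perm_image_stdSimp h
      rw [← hσ, hperm _ σ (isGenPerm_stdSimp hI)]
    choose! J hJ using hcard
    obtain ⟨c, hc⟩ := exists_sum_mul_fval_eq d fun m => φ (stdSimp d (J m))
    have hsimp : ∀ I : Finset (Fin d), I.Nonempty →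
        φ (stdSimp d I) = ∑ k ∈ Icc 1 (d - 1), c k * fval d k I.card := fun I hI => by
      have hId : #I ≤ d := by simpa using card_le_univ I
      rcases hI.card_pos.nat_succ_le.eq_or_lt with h1 | h1
      · obtain ⟨i, rfl⟩ := card_eq_one.1 h1.symm
        have h2 := htrans {0} (Pi.single i 1) isGenPerm_singleton_zero
        rw [Set.singleton_add_singleton, zero_add, ← stdSimp_singleton,
          hφ.map_singleton_zero] at h2
        rw [h2, sum_eq_zero fun k _ => by simp [fval]]
      · rw [hc #I (mem_Icc.2 ⟨h1, hId⟩)]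
        exact hcongr I _ hI (hJ _ hId).symm
    refine ⟨c, fun k hk => ?_, hsimp⟩
    have h1 := hnonneg _ (isGenPerm_hypersimplex k)
    rw [hφ.eq_sum_totalDefect hsimp (isGenPerm_hypersimplex k),
      sum_eq_single_of_mem k hk fun j hj hjk => by
        rw [totalDefect_hypersimplex_of_ne hj hk hjk, mul_zero]] at h1
    exact nonneg_of_mul_nonneg_left h1 (totalDefect_hypersimplex_pos hk)
  · rintro ⟨c, hc, hsimp⟩
    refine ⟨fun P hP => ?_, fun P t hP => ?_, fun P σ hP => ?_⟩
    · rw [hφ.eq_sum_totalDefect hsimp hP]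
      exact sum_nonneg fun k hk => mul_nonneg (hc k hk) (hP.totalDefect_nonneg k)
    · rw [hφ.eq_sum_totalDefect hsimp hP, hφ.eq_sum_totalDefect hsimp (hP.add_singleton t)]
      simp only [hP.totalDefect_add_singleton]
    · rw [hφ.eq_sum_totalDefect hsimp hP, hφ.eq_sum_totalDefect hsimp (hP.image_perm σ)]
      simp only [totalDefect_image_perm]
  · intro c c' hc hc' k hk
    refine sub_eq_zero.1 (eq_zero_of_sum_mul_fval_eq_zero (d := d) (c := c - c')
      (fun m hm => ?_) k hk)
    have hm' := mem_Icc.1 hm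
    obtain ⟨I, rfl⟩ := hcard m hm'.2
    have hI : I.Nonempty := card_pos.1 (by omega)
    simp only [Pi.sub_apply, sub_mul, sum_sub_distrib]
    rw [← hc I hI, ← hc' I hI, sub_self]
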